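/- Let K be a field, t ∈ K^×, and S a set of localities on K such that Assumption (U) holds for S and t. Let S_1, …, S_n ⊆ S be nonempty subsets, each compact in the topology T_{Zar*}, pairwise t-independent and pairwise incomparable. Let x′, x″ ∈ K and z_1, …, z_n ∈ K^× be such that z_i·O_w = z_j·O_w for every valuation ring O_w of K having a refinement in S_i and a refinement in S_j with i ≠ j, and such that x′ − x″ ∈ z_1·O_w for every valuation ring O_w having a refinement in S_1 and a refinement in S_i with i ≠ 1. Then there exists x ∈ K with x − x′ ∈ z_1·m_v for all v ∈ S_1, and x − x″ ∈ z_i·m_v for all v ∈ S_i with i ≠ 1. -/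

import Mathlib

namespace PaperApprox

variable {K : Type*} [Field K]

/-- The "maximal ideal" `m_O = O \ O^×` of a ball `O`, where `O^× = O ∩ O⁻¹` and
`O⁻¹ = {x⁻¹ : 0 ≠ x ∈ O} = {x | x ≠ 0 ∧ x⁻¹ ∈ O}`. -/
def mball (O : Set K) : Set K := O \ (O ∩ {x | x ≠ 0 ∧ x⁻¹ ∈ O})

/-- The scaled set `z·S`. -/
def scale (z : K) (S : Set K) : Set K := {y | ∃ s ∈ S, y = z * s}

/-- A positive cone of a field ordering. -/
def IsOrderingCone (P : Set K) : Prop :=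
  (∀ a ∈ P, ∀ b ∈ P, a + b ∈ P) ∧ (∀ a ∈ P, ∀ b ∈ P, a * b ∈ P) ∧
    (∀ x : K, x ∈ P ∨ -x ∈ P) ∧ ∀ x : K, x ∈ P → -x ∈ P → x = 0

/-- `x ≤_P y` for a positive cone `P`. -/
def coneLE (P : Set K) (a b : K) : Prop := b - a ∈ P

/-- `x <_P y` for a positive cone `P`. -/
def coneLT (P : Set K) (a b : K) : Prop := b - a ∈ P ∧ a ≠ b

/-- The unit interval `{x : -1 ≤_P x ≤_P 1}` of an ordering. -/
def orderingBall (P : Set K) : Set K := {x | x + 1 ∈ P ∧ 1 - x ∈ P}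

/-- `O` is the valuation ring of a (Krull) valuation on `K`. -/
def IsValuationLocality (O : Set K) : Prop := ∃ A : ValuationSubring K, O = (A : Set K)

/-- `O` is the unit interval of a field ordering of `K`. -/
def IsOrderingLocality (O : Set K) : Prop := ∃ P : Set K, IsOrderingCone P ∧ O = orderingBall P

/-- `O` is the closed unit ball of an absolute value on `K`. -/
def IsAbsLocality (O : Set K) : Prop := ∃ f : AbsoluteValue K ℝ, O = {x | f x ≤ 1}

/-- A locality on `K`, identified with its ring/ball `O`. -/
def IsLocality (O : Set K) : Prop := IsValuationLocality O ∨ IsOrderingLocality O ∨ IsAbsLocality O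

/-- `W` is the finest common coarsening of the localities `O₁`, `O₂`. -/
def IsFCC (O₁ O₂ W : Set K) : Prop :=
  IsLocality W ∧ O₁ ⊆ W ∧ O₂ ⊆ W ∧ ∀ W', IsLocality W' → O₁ ⊆ W' → O₂ ⊆ W' → W ⊆ W'

/-- Two subsets `A`, `B` of `W` have the same image in the residue field `W/m_W`. -/
def SameResidue (W A B : Set K) : Prop :=
  (∀ x ∈ A, ∃ y ∈ B, x - y ∈ mball W) ∧ ∀ y ∈ B, ∃ x ∈ A, x - y ∈ mball W

/-- Incomparability of localities. -/
def Incomp (O₁ O₂ : Set K) : Prop := ¬O₁ ⊆ O₂ ∧ ¬O₂ ⊆ O₁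

/-- Strong incomparability: incomparable, and the induced localities on the residue field of
the finest common coarsening are distinct (their rings, i.e. the images of `O₁` and `O₂`,
differ). -/
def StronglyIncomp (O₁ O₂ : Set K) : Prop :=
  Incomp O₁ O₂ ∧ ∀ W, IsFCC O₁ O₂ W → ¬SameResidue W O₁ O₂

/-- `t`-independence of localities. -/
def TIndep (t : K) (O₁ O₂ : Set K) : Prop :=
  (∀ W, IsFCC O₁ O₂ W → t ∈ W ∧ t⁻¹ ∈ W) ∧
    (IsOrderingLocality O₁ → IsOrderingLocality O₂ → StronglyIncomp O₁ O₂)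

/-- `t`-independence of valuation rings: `t` and `t⁻¹` lie in the smallest valuation ring
containing both. -/
def TIndepVal (t : K) (O₁ O₂ : Set K) : Prop :=
  ∀ W : Set K, IsValuationLocality W → O₁ ⊆ W → O₂ ⊆ W →
    (∀ W', IsValuationLocality W' → O₁ ⊆ W' → O₂ ⊆ W' → W ⊆ W') → t ∈ W ∧ t⁻¹ ∈ W

/-- `t`-independence of sets of localities. -/
def SetTIndep (t : K) (S₁ S₂ : Set (Set K)) : Prop := ∀ v ∈ S₁, ∀ w ∈ S₂, TIndep t v w

/-- Incomparability of sets of localities. -/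
def SetIncomp (S₁ S₂ : Set (Set K)) : Prop := ∀ v ∈ S₁, ∀ w ∈ S₂, Incomp v w

/-- Independence of localities: the field topologies they induce on `K` (with the sets
`z·m_v`, `z ∈ K^×`, as neighbourhood bases of `0`) are distinct. -/
def IndepLoc (O₁ O₂ : Set K) : Prop :=
  ¬((∀ z : K, z ≠ 0 → ∃ z' : K, z' ≠ 0 ∧ scale z' (mball O₂) ⊆ scale z (mball O₁)) ∧
     ∀ z : K, z ≠ 0 → ∃ z' : K, z' ≠ 0 ∧ scale z' (mball O₁) ⊆ scale z (mball O₂))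

/-- The Zariski topology on localities/balls of `K`. -/
def zarTop (K : Type*) [Field K] : TopologicalSpace (Set K) :=
  TopologicalSpace.generateFrom {U | ∃ x : K, U = {O : Set K | x ∈ O}}

/-- The Hochster dual of the Zariski topology. -/
def zarStarTop (K : Type*) [Field K] : TopologicalSpace (Set K) :=
  TopologicalSpace.generateFrom {U | ∃ x : K, U = {O : Set K | x ∈ mball O}}

/-- The constructible topology. -/
def conTop (K : Type*) [Field K] : TopologicalSpace (Set K) :=
  TopologicalSpace.generateFrom
    ({U | ∃ x : K, U = {O : Set K | x ∈ O}} ∪ {U | ∃ x : K, U = {O : Set K | x ∈ mball O}})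

/-- The Harrison topology on orderings (positive cones) of `K`. -/
def harrisonTop (K : Type*) [Field K] : TopologicalSpace (Set K) :=
  TopologicalSpace.generateFrom {U | ∃ x : K, x ≠ 0 ∧ U = {P : Set K | x ∈ P}}

/-- Condition (i): `f(O) ⊆ O`. -/
def CondI (f : Polynomial K) (O : Set K) : Prop := ∀ x ∈ O, f.eval x ∈ O

/-- Condition (ii): `f(x) ∉ t·m_O` for `x ∈ O`. -/
def CondII (t : K) (f : Polynomial K) (O : Set K) : Prop := ∀ x ∈ O, f.eval x ∉ scale t (mball O)

/-- Condition (iii): `f(x) ∈ x^d (O \ t·m_O) ∩ (a_d x^d + x^(d-1) O)` for `x ∉ O`. -/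
def CondIII (t : K) (f : Polynomial K) (O : Set K) : Prop :=
  ∀ x : K, x ∉ O →
    f.eval x ∈ scale (x ^ f.natDegree) (O \ scale t (mball O)) ∧
      ∃ u ∈ O, f.eval x = f.leadingCoeff * x ^ f.natDegree + x ^ (f.natDegree - 1) * u

/-- Condition (iv): `O + O ⊆ t⁻¹·O`. -/
def CondIV (t : K) (O : Set K) : Prop := ∀ a ∈ O, ∀ b ∈ O, a + b ∈ scale t⁻¹ O

/-- Assumption (U) for a set `S` of localities and `t ∈ K^×`. -/
def AssumptionU (S : Set (Set K)) (t : K) : Prop :=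
  ∃ f : Polynomial K, 2 ≤ f.natDegree ∧
    ∀ v ∈ S, CondI f v ∧ CondII t f v ∧ CondIII t f v ∧ CondIV t v

/-- Assumption (U-exc) for finitely many sets `S 1, …, S n` of localities and `t ∈ K^×`:
conditions (i), (iii), (iv) everywhere, and condition (ii) on the infinite `S i`. -/
def AssumptionUExc {n : ℕ} (S : Fin n → Set (Set K)) (t : K) : Prop :=
  ∃ f : Polynomial K, 2 ≤ f.natDegree ∧
    (∀ i, ∀ v ∈ S i, CondI f v ∧ CondIII t f v ∧ CondIV t v) ∧
      ∀ i, (S i).Infinite → ∀ v ∈ S i, CondII t f v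

/-- `S_π^e(K)`: valuation rings whose value group has a smallest positive element `γ`
(multiplicatively: a largest element `γ < 1`), such that `ℤγ` is convex and
`0 < v(π) ≤ eγ` (multiplicatively `γ^e ≤ v(π) < 1`). -/
def SPiE (π : K) (e : ℕ) : Set (Set K) :=
  {O | ∃ A : ValuationSubring K, O = (A : Set K) ∧
    ∃ γ : A.ValueGroup, γ ≠ 0 ∧ γ < 1 ∧
      (∀ δ : A.ValueGroup, δ ≠ 0 → δ < 1 → δ ≤ γ) ∧
      (∀ δ : A.ValueGroup, δ ≠ 0 → ∀ m n : ℤ, γ ^ m ≤ δ → δ ≤ γ ^ n → ∃ k : ℤ, δ = γ ^ k) ∧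
      A.valuation π < 1 ∧ γ ^ e ≤ A.valuation π}

/-- `O_w` is convex with respect to the ordering with positive cone `P`. -/
def ConvexWrtOrdering (P W : Set K) : Prop :=
  ∀ u w : K, u ∈ P → w - u ∈ P → w ∈ W → u ∈ W

/-- Iterated application `φ(x₁, φ(x₂, …))`. -/
def iterPhi (φ : K → K → K) : K → List K → K
  | x, [] => x
  | x, y :: l => φ x (iterPhi φ y l)

/-- Basic multiplicative properties shared by all localities. -/
structure Good (O : Set K) : Prop where
  mul : ∀ a ∈ O, ∀ b ∈ O, a * b ∈ O
  one : (1 : K) ∈ O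
  zero : (0 : K) ∈ O
  neg : ∀ a ∈ O, -a ∈ O
  tot : ∀ a : K, a ∈ O ∨ a⁻¹ ∈ O

theorem mem_mball {O : Set K} {x : K} : x ∈ mball O ↔ x ∈ O ∧ (x = 0 ∨ x⁻¹ ∉ O) := by
  simp only [mball, Set.mem_diff, Set.mem_inter_iff, Set.mem_setOf_eq]
  tauto

theorem mem_scale {z : K} (hz : z ≠ 0) {O : Set K} {x : K} : x ∈ scale z O ↔ z⁻¹ * x ∈ O := by
  constructor
  · rintro ⟨s, hs, rfl⟩
    rwa [inv_mul_cancel_left₀ hz]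
  · intro h
    exact ⟨_, h, by rw [mul_inv_cancel_left₀ hz]⟩

theorem Good.mball_mul {O : Set K} (h : Good O) {a x : K} (ha : a ∈ O) (hx : x ∈ mball O) :
    a * x ∈ mball O := by
  rw [mem_mball] at *
  refine ⟨h.mul _ ha _ hx.1, ?_⟩
  by_cases h0 : a * x = 0
  · exact Or.inl h0
  · right
    intro hc
    have ha0 : a ≠ 0 := left_ne_zero_of_mul h0
    have hx0 : x ≠ 0 := right_ne_zero_of_mul h0
    rcases hx.2 with h1 | h1
    · exact hx0 h1
    · apply h1
      have := h.mul _ ha _ hc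
      rwa [mul_inv, mul_inv_cancel_left₀ ha0] at this

theorem Good.inv_mem_mball {O : Set K} (h : Good O) {x : K} (hx : x ∉ O) : x⁻¹ ∈ mball O := by
  rw [mem_mball]
  exact ⟨(h.tot x).resolve_left hx, Or.inr (by rwa [inv_inv])⟩

/-- if `x ∉ mball O` then `x⁻¹ ∈ O`. -/
theorem Good.inv_mem_of_not {O : Set K} (h : Good O) {x : K} (hx : x ∉ mball O) : x⁻¹ ∈ O := by
  by_contra hc
  apply hx
  simpa using h.inv_mem_mball hc

theorem mball_sub {O : Set K} {x : K} (h : x ∈ mball O) : x ∈ O := h.1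

theorem Good.pow {O : Set K} (h : Good O) {x : K} (hx : x ∈ O) (n : ℕ) : x ^ n ∈ O := by
  induction n with
  | zero => simpa using h.one
  | succ k ih => rw [pow_succ]; exact h.mul _ ih _ hx

theorem Good.not_mem_of_inv {O : Set K} {x : K} (h0 : x ≠ 0) (hx : x⁻¹ ∈ mball O) :
    x ∉ O := by
  rw [mem_mball] at hx
  rcases hx.2 with h | h
  · exact absurd (inv_eq_zero.1 h) h0
  · simpa using h

theorem good_val (A : ValuationSubring K) : Good (A : Set K) :=
  ⟨fun _ ha _ hb => A.mul_mem _ _ ha hb, A.one_mem, A.zero_mem, fun _ ha => A.neg_mem _ ha,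
    A.mem_or_inv_mem⟩

theorem good_abs (f : AbsoluteValue K ℝ) : Good {x | f x ≤ 1} := by
  refine ⟨?_, by simp, by simp, by simp, ?_⟩
  · intro a ha b hb
    simp only [Set.mem_setOf_eq, map_mul] at *
    exact mul_le_one₀ ha (f.nonneg _) hb
  · intro a
    simp only [Set.mem_setOf_eq, map_inv₀]
    rcases le_total (f a) 1 with h | h
    · exact Or.inl h
    · exact Or.inr (inv_le_one_of_one_le₀ h)

theorem cone_order {P : Set K} (hP : IsOrderingCone P) :
    ∃ (_ : LinearOrder K) (_ : IsStrictOrderedRing K), ∀ x : K, x ∈ P ↔ 0 ≤ x := by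
  classical
  obtain ⟨hadd, hmul, htot, hanti⟩ := hP
  have h0 : (0 : K) ∈ P := by
    rcases htot 0 with h | h
    · exact h
    · simpa using h
  let L : LinearOrder K :=
    { le := fun a b => b - a ∈ P
      le_refl := fun a => by simpa using h0
      le_trans := fun a b c h1 h2 => by
        have := hadd _ h1 _ h2
        have e : b - a + (c - b) = c - a := by ring
        rwa [e] at this
      le_antisymm := fun a b h1 h2 => by
        have := hanti (b - a) h1 (by rwa [neg_sub])
        exact (sub_eq_zero.1 this).symm
      le_total := fun a b => by
        have := htot (b - a)
        rwa [neg_sub] at this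
      toDecidableLE := Classical.decRel _ }
  have hle : ∀ a b : K, a ≤ b ↔ b - a ∈ P := fun a b => Iff.rfl
  have hO : IsOrderedAddMonoid K :=
    { add_le_add_left := fun a b h c => by
        rw [hle] at *
        simpa using h }
  have h01 : (0 : K) ≤ 1 := by
    rw [hle, sub_zero]
    rcases htot 1 with h | h
    · exact h
    · simpa using hmul _ h _ h
  have hz : ZeroLEOneClass K := ⟨h01⟩
  have hR : IsStrictOrderedRing K := IsStrictOrderedRing.of_mul_pos (by
    intro a b ha hb
    refine lt_of_le_of_ne ?_ (mul_ne_zero ha.ne' hb.ne').symm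
    have h1 := (hle _ _).1 ha.le
    have h2 := (hle _ _).1 hb.le
    rw [sub_zero] at h1 h2
    rw [hle, sub_zero]
    exact hmul _ h1 _ h2)
  exact ⟨L, hR, fun x => by rw [hle, sub_zero]⟩

theorem ord_order {O : Set K} (hO : IsOrderingLocality O) :
    ∃ (_ : LinearOrder K) (_ : IsStrictOrderedRing K), ∀ x : K, x ∈ O ↔ |x| ≤ 1 := by
  obtain ⟨P, hP, rfl⟩ := hO
  obtain ⟨L, hR, h⟩ := cone_order hP
  refine ⟨L, hR, fun x => ?_⟩
  simp only [orderingBall, Set.mem_setOf_eq, h, abs_le]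
  constructor
  · rintro ⟨h1, h2⟩; constructor <;> linarith
  · rintro ⟨h1, h2⟩; constructor <;> linarith

theorem good_ord {O : Set K} (hO : IsOrderingLocality O) : Good O := by
  obtain ⟨L, hR, h⟩ := ord_order hO
  refine ⟨?_, by simp [h], by simp [h], by simp [h], ?_⟩
  · intro a ha b hb
    rw [h] at *
    rw [abs_mul]
    exact mul_le_one₀ ha (abs_nonneg _) hb
  · intro a
    rw [h, h, abs_inv]
    rcases le_total |a| 1 with h | h
    · exact Or.inl h
    · exact Or.inr (inv_le_one_of_one_le₀ h)

theorem good_loc {O : Set K} (hO : IsLocality O) : Good O := by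
  rcases hO with ⟨A, rfl⟩ | h | ⟨f, rfl⟩
  · exact good_val A
  · exact good_ord h
  · exact good_abs f

/-- archimedean absolute value locality -/
def IsArch (O : Set K) : Prop :=
  ∃ (f : AbsoluteValue K ℝ) (N : ℕ), 1 < f (N : K) ∧ O = {x | f x ≤ 1}

theorem exp_beats {a : ℝ} (h : ∀ n : ℕ, a ^ n ≤ n + 1) : a ≤ 1 := by
  by_contra hc
  push Not at hc
  obtain ⟨n, hn⟩ := exists_nat_gt (2 / (a - 1) ^ 2)
  have hd : 0 < (a - 1) ^ 2 := by have : 0 < a - 1 := by linarith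
                                  positivity
  rw [div_lt_iff₀ hd] at hn
  have h1 := one_add_mul_le_pow (a := a - 1) (by linarith) n
  have h2 := h (2 * n)
  rw [add_sub_cancel] at h1
  rw [mul_comm, pow_mul] at h2
  push_cast at h2
  have hn0 : (0 : ℝ) ≤ n := Nat.cast_nonneg n
  have hnp : (0 : ℝ) < n := by
    rcases hn0.eq_or_lt with h | h
    · rw [← h] at hn; linarith
    · exact h
  have h3 : 0 ≤ n * (a - 1) := by apply mul_nonneg hn0; linarith
  have h4 : (1 + n * (a - 1)) ^ 2 ≤ (a ^ n) ^ 2 := by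
    apply pow_le_pow_left₀ _ h1
    linarith
  nlinarith [mul_lt_mul_of_pos_left hn hnp]

theorem bdd_pow {a c : ℝ} (h : ∀ n : ℕ, a ^ n ≤ c) : a ≤ 1 := by
  by_contra hc
  push Not at hc
  obtain ⟨n, hn⟩ := pow_unbounded_of_one_lt c hc
  exact absurd (h n) (not_le.2 hn)

theorem val_of_add {O : Set K} (h : Good O) (hadd : ∀ a ∈ O, ∀ b ∈ O, a + b ∈ O) :
    ∃ A : ValuationSubring K, (A : Set K) = O :=
  ⟨{ carrier := O
     mul_mem' := fun ha hb => h.mul _ ha _ hb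
     one_mem' := h.one
     add_mem' := fun ha hb => hadd _ ha _ hb
     zero_mem' := h.zero
     neg_mem' := fun ha => h.neg _ ha
     mem_or_inv_mem' := h.tot }, rfl⟩

theorem loc_cases {O : Set K} (hO : IsLocality O) :
    IsValuationLocality O ∨ IsOrderingLocality O ∨ IsArch O := by
  rcases hO with h | h | ⟨f, rfl⟩
  · exact Or.inl h
  · exact Or.inr (Or.inl h)
  · by_cases hN : ∃ N : ℕ, 1 < f (N : K)
    · obtain ⟨N, hN⟩ := hN
      exact Or.inr (Or.inr ⟨f, N, hN, rfl⟩)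
    · push Not at hN
      left
      obtain ⟨A, hA⟩ := val_of_add (good_abs f) (by
        intro a ha b hb
        simp only [Set.mem_setOf_eq] at *
        apply exp_beats
        intro n
        rw [← map_pow, add_pow]
        refine (f.sum_le _ _).trans ?_
        have : ∀ i ∈ Finset.range (n + 1), f (a ^ i * b ^ (n - i) * (n.choose i : ℕ)) ≤ 1 := by
          intro i _
          simp only [map_mul, map_pow]
          have h1 : f a ^ i ≤ 1 := pow_le_one₀ (f.nonneg _) ha
          have h2 : f b ^ (n - i) ≤ 1 := pow_le_one₀ (f.nonneg _) hb
          have h3 := hN (n.choose i)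
          have h4 : f a ^ i * f b ^ (n - i) ≤ 1 :=
            mul_le_one₀ h1 (pow_nonneg (f.nonneg _) _) h2
          exact mul_le_one₀ h4 (f.nonneg _) h3
        refine (Finset.sum_le_sum this).trans ?_
        simp)
      exact ⟨A, hA.symm⟩

theorem hm_symm {v v' : Set K} (hv : Good v) {s : K} (hs : s ≠ 0)
    (hm : ∀ x ∈ mball v, s⁻¹ * x ∈ v') : ∀ x ∈ mball v', s⁻¹ * x ∈ v := by
  intro x hx
  by_contra hc
  have h1 := hm _ (hv.inv_mem_mball hc)
  rw [mul_inv, inv_inv, inv_mul_cancel_left₀ hs] at h1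
  rcases (mem_mball.1 hx).2 with h | h
  · apply hc
    rw [h, mul_zero]
    exact hv.zero
  · exact h h1

theorem ord_half {O : Set K} (hO : IsOrderingLocality O) : (2 : K) ≠ 0 ∧ (2 : K) ∉ O ∧
    ∀ x ∈ O, (2 : K)⁻¹ * x ∈ mball O := by
  have hG := good_ord hO
  obtain ⟨L, hR, h⟩ := ord_order hO
  have h2 : (2 : K) ∉ O := by
    rw [h, abs_of_pos (by norm_num)]
    norm_num
  refine ⟨by norm_num, h2, fun x hx => ?_⟩
  rw [mul_comm]
  exact hG.mball_mul hx (hG.inv_mem_mball h2)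

theorem exists_N {O : Set K} (hO : IsOrderingLocality O ∨ IsArch O) :
    ∃ N : ℕ, (N : K) ≠ 0 ∧ (N : K) ∉ O ∧ ∀ x ∈ O, (N : K)⁻¹ * x ∈ mball O := by
  rcases hO with h | ⟨f, N, hN, rfl⟩
  · exact ⟨2, by exact_mod_cast ord_half h⟩
  · have hG := good_abs f
    have h2 : (N : K) ∉ {x | f x ≤ 1} := not_le.2 hN
    refine ⟨N, ?_, h2, fun x hx => ?_⟩
    · intro h
      rw [h, map_zero] at hN
      linarith
    · rw [mul_comm]
      exact hG.mball_mul hx (hG.inv_mem_mball h2)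

theorem abs_absorb {v : Set K} (hv : Good v) (f : AbsoluteValue K ℝ) {N s : K} (hN : N ≠ 0)
    (hs : s ≠ 0) (hNv : ∀ x ∈ v, N⁻¹ * x ∈ mball v)
    (hm : ∀ x ∈ mball v, s⁻¹ * x ∈ {x | f x ≤ 1}) : v ⊆ {x | f x ≤ 1} := by
  intro x hx
  change f x ≤ 1
  apply bdd_pow (c := f (s * N))
  intro n
  have h1 : f (s⁻¹ * (N⁻¹ * x ^ n)) ≤ 1 := hm _ (hNv _ (hv.pow hx n))
  have h2 : f (x ^ n) = f (s * N) * f (s⁻¹ * (N⁻¹ * x ^ n)) := by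
    rw [← map_mul]
    congr 1
    field_simp
  rw [← map_pow, h2]
  exact mul_le_of_le_one_right (f.nonneg _) h1

theorem ord_ord {v W : Set K} (hv : IsOrderingLocality v) (hW : IsOrderingLocality W)
    (h : v ⊆ W) : W ⊆ v := by
  have sq : ∀ P : Set K, IsOrderingCone P → ∀ x : K, x * x ∈ P := by
    intro P hP x
    rcases hP.2.2.1 x with h | h
    · exact hP.2.1 _ h _ h
    · simpa using hP.2.1 _ h _ h
  obtain ⟨P, hP, rfl⟩ := hv
  obtain ⟨Q, hQ, rfl⟩ := hW
  have hA : ∀ x ∈ P, 1 - x ∈ P → x ∈ Q := by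
    intro x hx hx1
    have h1 : x + x - 1 ∈ orderingBall P := by
      constructor
      · have := hP.1 _ hx _ hx
        rwa [sub_add_cancel]
      · have := hP.1 _ hx1 _ hx1
        have e : 1 - (x + x - 1) = 1 - x + (1 - x) := by ring
        rwa [e]
    have h2 := (h h1).1
    rw [sub_add_cancel] at h2
    rcases hQ.2.2.1 x with h3 | h3
    · exact h3
    · have := hQ.1 _ h2 _ h3
      rwa [add_neg_cancel_right] at this
  have hPQ : ∀ x ∈ P, x ∈ Q := by
    intro x hx
    by_cases hx0 : x = 0
    · subst hx0
      simpa using sq Q hQ 0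
    rcases hP.2.2.1 (1 - x) with h1 | h1
    · exact hA x hx h1
    · rw [neg_sub] at h1
      have h2 : x⁻¹ ∈ P := by
        have := hP.2.1 _ hx _ (sq P hP x⁻¹)
        rwa [mul_inv_cancel_left₀ hx0] at this
      have h3 : x⁻¹ ∈ Q := by
        apply hA _ h2
        have := hP.2.1 _ h1 _ h2
        rwa [sub_mul, mul_inv_cancel₀ hx0, one_mul] at this
      have := hQ.2.1 _ h3 _ (sq Q hQ x)
      rwa [inv_mul_cancel_left₀ hx0] at this
  have hQP : ∀ x ∈ Q, x ∈ P := by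
    intro x hx
    rcases hP.2.2.1 x with h1 | h1
    · exact h1
    · have := hQ.2.2.2 x hx (hPQ _ h1)
      subst this
      simpa using h1
  rintro x ⟨h1, h2⟩
  exact ⟨hQP _ h1, hQP _ h2⟩

theorem ord_arch {v W : Set K} (hv : IsOrderingLocality v) (hW : IsArch W)
    (h : v ⊆ W) : W ⊆ v := by
  have hGv := good_ord hv
  have hsym : ∀ x ∈ mball W, x ∈ v := by
    have := hm_symm (v := v) (v' := W) hGv (one_ne_zero (α := K))
      (fun x hx => by simpa using h (mball_sub hx))
    simpa using this
  obtain ⟨f, N, hN, rfl⟩ := hW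
  have hG := good_abs f
  obtain ⟨L, hR, ho⟩ := ord_order hv
  intro x hx
  by_contra hc
  rw [ho, not_le] at hc
  have hNn : 0 < N := by
    rcases Nat.eq_zero_or_pos N with h0 | h0
    · subst h0
      simp at hN
      linarith
    · exact h0
  have hN0 : (0 : K) < N := by exact_mod_cast hNn
  have hpow : ∀ n : ℕ, |x| ^ n ≤ N := by
    intro n
    have h1 : x ^ n * (N : K)⁻¹ ∈ v :=
      hsym _ (hG.mball_mul (hG.pow hx n) (hG.inv_mem_mball (not_le.2 hN)))
    rw [ho, abs_mul, abs_inv, abs_of_pos hN0, abs_pow, ← div_eq_mul_inv, div_le_one hN0] at h1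
    exact h1
  obtain ⟨y, hy⟩ : ∃ y, |x| = 1 + y := ⟨|x| - 1, by ring⟩
  have hy0 : 0 < y := by linarith
  have hfy : 0 < f y := f.pos hy0.ne'
  have hb : ∀ n : ℕ, f (n : K) * f y ≤ f N := by
    intro n
    have h1 := one_add_mul_le_pow (a := y) (by linarith) n
    rw [← hy] at h1
    have h2 : n * y ≤ N := by linarith [hpow n]
    have h3 : (n : K) * y / N ∈ v := by
      rw [ho, abs_of_nonneg (by positivity), div_le_one hN0]
      exact h2
    have h4 : f ((n : K) * y / N) ≤ 1 := h h3
    rw [map_div₀, map_mul, div_le_one (by linarith)] at h4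
    exact h4
  have : f N ≤ 1 := by
    apply bdd_pow (c := f N / f y)
    intro n
    rw [le_div_iff₀ hfy, ← map_pow]
    exact_mod_cast hb (N ^ n)
  linarith

theorem eqW {v W : Set K} (hv : IsLocality v) (hW : IsOrderingLocality W ∨ IsArch W)
    (h : v ⊆ W) : W ⊆ v := by
  rcases loc_cases hv with ⟨A, rfl⟩ | h1 | h1
  · obtain ⟨N, _, hN, _⟩ := exists_N hW
    exact absurd (h (natCast_mem A N)) hN
  · rcases hW with hW | hW
    · exact ord_ord h1 hW h
    · exact ord_arch h1 hW h
  · have hsym : ∀ x ∈ mball W, (1 : K)⁻¹ * x ∈ v :=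
      hm_symm (v := v) (v' := W) (good_loc hv) (one_ne_zero (α := K))
      (fun x hx => by simpa using h (mball_sub hx))
    obtain ⟨N, hN0, hN, hNm⟩ := exists_N hW
    have hGW : Good W := by
      rcases hW with hW | ⟨f, N, _, rfl⟩
      · exact good_ord hW
      · exact good_abs f
    obtain ⟨f, N', _, rfl⟩ := h1
    exact abs_absorb hGW f hN0 one_ne_zero hNm hsym

theorem exists_W {v : Set K} (hv : Good v) (v' : Set K) : ∃ W : ValuationSubring K,
    v ⊆ W ∧ v' ⊆ W ∧ ∀ A : ValuationSubring K, v ⊆ A → v' ⊆ A → W ≤ A := by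
  refine ⟨{ (⨅ A : {A : ValuationSubring K // v ⊆ A ∧ v' ⊆ A}, A.1.toSubring) with
    mem_or_inv_mem' := ?_ }, ?_, ?_, ?_⟩
  · intro x
    change x ∈ (⨅ A : {A : ValuationSubring K // v ⊆ A ∧ v' ⊆ A}, A.1.toSubring) ∨
      x⁻¹ ∈ (⨅ A : {A : ValuationSubring K // v ⊆ A ∧ v' ⊆ A}, A.1.toSubring)
    simp only [Subring.mem_iInf]
    by_contra hc
    push Not at hc
    obtain ⟨⟨A, hA⟩, ⟨B, hB⟩⟩ := hc
    obtain ⟨A, hA1, _⟩ := A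
    obtain ⟨B, hB1, _⟩ := B
    change x ∉ A at hA
    change x⁻¹ ∉ B at hB
    have hx0 : x ≠ 0 := by
      rintro rfl
      exact hA A.zero_mem
    have h1 := (A.mem_or_inv_mem x).resolve_left hA
    have h2 := (B.mem_or_inv_mem x).resolve_right hB
    rcases hv.tot x with h | h
    · exact hA (hA1 h)
    · exact hB (hB1 h)
  · intro x hx
    change x ∈ (⨅ A : {A : ValuationSubring K // v ⊆ A ∧ v' ⊆ A}, A.1.toSubring)
    rw [Subring.mem_iInf]
    exact fun A => A.2.1 hx
  · intro x hx
    change x ∈ (⨅ A : {A : ValuationSubring K // v ⊆ A ∧ v' ⊆ A}, A.1.toSubring)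
    rw [Subring.mem_iInf]
    exact fun A => A.2.2 hx
  · intro A h1 h2 x hx
    change x ∈ (⨅ A : {A : ValuationSubring K // v ⊆ A ∧ v' ⊆ A}, A.1.toSubring) at hx
    rw [Subring.mem_iInf] at hx
    exact hx ⟨A, h1, h2⟩

theorem isFCC_of {v v' : Set K} (hv : IsLocality v) (hi : Incomp v v')
    (W : ValuationSubring K) (h1 : v ⊆ W) (h2 : v' ⊆ W)
    (hmin : ∀ A : ValuationSubring K, v ⊆ A → v' ⊆ A → W ≤ A) : IsFCC v v' (W : Set K) := by
  refine ⟨Or.inl ⟨W, rfl⟩, h1, h2, ?_⟩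
  intro W' hW' h3 h4
  rcases loc_cases hW' with ⟨A, rfl⟩ | h
  · exact hmin A h3 h4
  · exact absurd (h4.trans (eqW hv h h3)) hi.2

theorem prod_mem {A B : Set K} (hA : Good A) (hB : Good B)
    (hadd : ∀ a ∈ B, ∀ b ∈ B, a + b ∈ B) (W : ValuationSubring K)
    (hmin : ∀ V : ValuationSubring K, A ⊆ V → B ⊆ V → W ≤ V) :
    ∀ x ∈ W, ∃ a ∈ A, ∃ b ∈ B, x = a * b := by
  let R : Set K := {x | ∃ a ∈ A, ∃ b ∈ B, x = a * b}
  have key : ∀ x ∈ R, ∀ y, y / x ∈ B → x ≠ 0 → x + y ∈ R := by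
    rintro x ⟨a, ha, b, hb, rfl⟩ y hy hx
    refine ⟨a, ha, b * (1 + y / (a * b)), hB.mul _ hb _ (hadd _ hB.one _ hy), ?_⟩
    have : a ≠ 0 := left_ne_zero_of_mul hx
    have : b ≠ 0 := right_ne_zero_of_mul hx
    field_simp
  have hAR : A ⊆ R := fun a ha => ⟨a, ha, 1, hB.one, by simp⟩
  have hBR : B ⊆ R := fun b hb => ⟨1, hA.one, b, hb, by simp⟩
  have hR : Good R := by
    refine ⟨?_, hAR hA.one, hAR hA.zero, ?_, ?_⟩
    · rintro x ⟨a, ha, b, hb, rfl⟩ y ⟨a', ha', b', hb', rfl⟩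
      exact ⟨a * a', hA.mul _ ha _ ha', b * b', hB.mul _ hb _ hb', by ring⟩
    · rintro x ⟨a, ha, b, hb, rfl⟩
      exact ⟨-a, hA.neg _ ha, b, hb, by ring⟩
    · intro x
      rcases hA.tot x with h | h
      · exact Or.inl (hAR h)
      · exact Or.inr (hAR h)
  obtain ⟨V, hV⟩ := val_of_add hR (by
    intro x hx y hy
    by_cases hx0 : x = 0
    · simpa [hx0] using hy
    by_cases hy0 : y = 0
    · simpa [hy0] using hx
    rcases hB.tot (y / x) with h | h
    · exact key x hx y h hx0
    · rw [inv_div] at h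
      rw [add_comm]
      exact key y hy x h hy0)
  intro x hx
  have h1 : x ∈ (V : Set K) := hmin V (by rw [hV]; exact hAR) (by rw [hV]; exact hBR) hx
  rw [hV] at h1
  exact h1

theorem val_case {v v' : Set K} (hv : Good v) (hv' : Good v') (hi : Incomp v v')
    (W : ValuationSubring K) (h1 : v ⊆ W) (h2 : v' ⊆ W)
    (hprod : ∀ x ∈ W, ∃ a ∈ v, ∃ b ∈ v', x = a * b)
    {s : K} (hs : s ≠ 0) (hsW : s ∈ W) (hm : ∀ x ∈ mball v, s⁻¹ * x ∈ v') : False := by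
  by_cases h : ∀ u ∈ mball v, u ≠ 0 → u⁻¹ ∉ W
  · apply hi.2
    intro x hx
    by_contra hc
    have hx0 : x ≠ 0 := by
      rintro rfl
      exact hc hv.zero
    refine h _ (hv.inv_mem_mball hc) (inv_ne_zero hx0) ?_
    rw [inv_inv]
    exact h2 hx
  · push Not at h
    obtain ⟨u, hu, hu0, huW⟩ := h
    apply hi.1
    intro x hx
    obtain ⟨a, ha, b, hb, hab⟩ := hprod _ (W.mul_mem _ _ huW (W.mul_mem _ _ hsW (h1 hx)))
    have h3 := hv'.mul _ (hm _ (hv.mball_mul ha hu)) _ hb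
    have e : s⁻¹ * (a * u) * b = s⁻¹ * u * (a * b) := by ring
    rw [e, ← hab] at h3
    have e2 : s⁻¹ * u * (u⁻¹ * (s * x)) = x := by field_simp
    rwa [e2] at h3

theorem hull {O : Set K} (hO : IsOrderingLocality O) : ∃ A : ValuationSubring K,
    ∀ x, x ∈ A ↔ ∃ n : ℕ, ((2 : K) ^ n)⁻¹ * x ∈ O := by
  obtain ⟨L, hR, ho⟩ := ord_order hO
  have hiff : ∀ (x : K) (n : ℕ), ((2 : K) ^ n)⁻¹ * x ∈ O ↔ |x| ≤ 2 ^ n := by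
    intro x n
    rw [ho, abs_mul, abs_inv, abs_of_pos (by positivity : (0 : K) < 2 ^ n), inv_mul_le_one₀
      (by positivity)]
  simp only [hiff]
  have hG : Good {x : K | ∃ n : ℕ, |x| ≤ 2 ^ n} := by
    refine ⟨?_, ⟨0, by simp⟩, ⟨0, by simp⟩, by simp, ?_⟩
    · rintro a ⟨n, hn⟩ b ⟨m, hm⟩
      refine ⟨n + m, ?_⟩
      rw [abs_mul, pow_add]
      gcongr
    · intro a
      rcases le_total |a| 1 with h | h
      · exact Or.inl ⟨0, by simpa using h⟩
      · refine Or.inr ⟨0, ?_⟩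
        rw [abs_inv, pow_zero]
        exact inv_le_one_of_one_le₀ h
  obtain ⟨A, hA⟩ := val_of_add hG (by
    rintro a ⟨n, hn⟩ b ⟨m, hm⟩
    refine ⟨max n m + 1, (abs_add_le a b).trans ?_⟩
    have h1 : (2 : K) ^ n ≤ 2 ^ (max n m) := pow_le_pow_right₀ (by norm_num) (le_max_left _ _)
    have h2 : (2 : K) ^ m ≤ 2 ^ (max n m) := pow_le_pow_right₀ (by norm_num) (le_max_right _ _)
    rw [pow_succ]
    linarith)
  refine ⟨A, fun x => ?_⟩
  rw [← SetLike.mem_coe, hA]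
  rfl

theorem ord_res_half {v v' : Set K} (hv : IsOrderingLocality v) (hv' : IsOrderingLocality v')
    (W : ValuationSubring K) (h1 : v ⊆ W)
    (hmin : ∀ A : ValuationSubring K, v ⊆ A → v' ⊆ A → W ≤ A)
    {s : K} (hs : s ≠ 0) (hsW : s ∈ W) (hm : ∀ x ∈ mball v, s⁻¹ * x ∈ v') :
    ∀ x ∈ v, ∃ y ∈ v', x - y ∈ mball (W : Set K) := by
  obtain ⟨A, hA⟩ := hull hv
  obtain ⟨B, hB⟩ := hull hv'
  obtain ⟨h20, -, h2m⟩ := ord_half hv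
  have hAB : ∀ a ∈ A, s⁻¹ * a ∈ B := by
    intro a ha
    obtain ⟨n, hn⟩ := (hA a).1 ha
    rw [hB]
    refine ⟨n + 1, ?_⟩
    have := hm _ (h2m _ hn)
    convert this using 1
    field_simp
    ring
  have hprod := prod_mem (good_val A) (good_val B) (fun _ ha _ hb => B.add_mem _ _ ha hb) W
    (fun V hVA hVB => hmin V
      (fun x hx => hVA ((hA x).2 ⟨0, by simpa using hx⟩))
      (fun x hx => hVB ((hB x).2 ⟨0, by simpa using hx⟩)))
  have hWB : ∀ x ∈ W, x ∈ B := by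
    intro x hx
    obtain ⟨a, ha, b, hb, hab⟩ := hprod _ (W.mul_mem _ _ hsW hx)
    have h3 := B.mul_mem _ _ (hAB a ha) hb
    have e : s⁻¹ * a * b = s⁻¹ * (a * b) := by ring
    rw [e, ← hab, inv_mul_cancel_left₀ hs] at h3
    exact h3
  have hGv := good_ord hv
  have hGv' := good_ord hv'
  obtain ⟨L, hR, ho⟩ := ord_order hv'
  have hiff : ∀ (x : K) (n : ℕ), ((2 : K) ^ n)⁻¹ * x ∈ v' ↔ |x| ≤ 2 ^ n := by
    intro x n
    rw [ho, abs_mul, abs_inv, abs_of_pos (by positivity : (0 : K) < 2 ^ n), inv_mul_le_one₀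
      (by positivity)]
  obtain ⟨k, hk⟩ := (hB s).1 (hWB s hsW)
  rw [hiff] at hk
  have main : ∀ x ∈ v, 1 < x → x - 1 ∈ mball (W : Set K) := by
    intro x hx hx1
    by_contra hc
    have hinv : (x - 1)⁻¹ ∈ W := (good_val W).inv_mem_of_not hc
    obtain ⟨m, hm'⟩ := (hB _).1 (hWB _ hinv)
    rw [hiff, abs_of_pos (by rw [inv_pos]; linarith), inv_le_iff_one_le_mul₀ (by linarith)] at hm'
    have hpow : x ^ (2 ^ (m + k + 1)) ≤ 2 ^ (k + 1) := by
      have h3 := hm _ (h2m _ (hGv.pow hx (2 ^ (m + k + 1))))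
      rw [ho, abs_mul, abs_mul, abs_inv, inv_mul_le_one₀ (abs_pos.2 hs), abs_inv,
        abs_of_pos (by norm_num : (0 : K) < 2), abs_of_pos (by positivity),
        inv_mul_le_iff₀ (by norm_num)] at h3
      rw [pow_succ (2 : K) k]
      linarith
    have h4 := one_add_mul_le_pow (a := x - 1) (by linarith) (2 ^ (m + k + 1))
    rw [add_sub_cancel] at h4
    push_cast at h4
    have h5 : (2 : K) ^ (m + k + 1) * (x - 1) = 2 ^ (k + 1) * (2 ^ m * (x - 1)) := by ring
    have h6 : (2 : K) ^ (k + 1) * 1 ≤ 2 ^ (k + 1) * (2 ^ m * (x - 1)) := by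
      gcongr
    linarith
  intro x hx
  by_cases hxv : x ∈ v'
  · exact ⟨x, hxv, by rw [sub_self, mem_mball]; exact ⟨W.zero_mem, Or.inl rfl⟩⟩
  · rw [ho, not_le, lt_abs] at hxv
    rcases hxv with h | h
    · exact ⟨1, hGv'.one, main x hx h⟩
    · refine ⟨-1, hGv'.neg _ hGv'.one, ?_⟩
      have h3 := main (-x) (hGv.neg _ hx) h
      have h4 := (good_val W).mball_mul ((good_val W).neg _ (good_val W).one) h3
      have e : x - -1 = -1 * (-x - 1) := by ring
      rw [e]
      exact h4

theorem mball_neg {O : Set K} (h : Good O) {x : K} (hx : x ∈ mball O) : -x ∈ mball O := by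
  have := h.mball_mul (h.neg _ h.one) hx
  simpa using this

theorem pair_contra {v v' : Set K} (hv : IsLocality v) (hv' : IsLocality v')
    (hi : Incomp v v') (W : ValuationSubring K) (h1 : v ⊆ W) (h2 : v' ⊆ W)
    (hmin : ∀ A : ValuationSubring K, v ⊆ A → v' ⊆ A → W ≤ A)
    (hres : IsOrderingLocality v → IsOrderingLocality v' → ¬ SameResidue (W : Set K) v v')
    {s : K} (hs : s ≠ 0) (hsW : s ∈ W) (hm : ∀ x ∈ mball v, s⁻¹ * x ∈ v') : False := by
  have hG := good_loc hv
  have hG' := good_loc hv'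
  have hm' := hm_symm hG hs hm
  have hi' : Incomp v' v := ⟨hi.2, hi.1⟩
  rcases loc_cases hv' with ⟨B, rfl⟩ | hnv'
  · exact val_case hG hG' hi W h1 h2
      (prod_mem hG hG' (fun _ ha _ hb => B.add_mem _ _ ha hb) W hmin) hs hsW hm
  rcases loc_cases hv with ⟨A, rfl⟩ | hnv
  · exact val_case hG' hG hi' W h2 h1
      (prod_mem hG' hG (fun _ ha _ hb => A.add_mem _ _ ha hb) W
        (fun V a b => hmin V b a)) hs hsW hm'
  obtain ⟨N, hN0, _, hN⟩ := exists_N hnv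
  obtain ⟨N', hN0', _, hN'⟩ := exists_N hnv'
  rcases hnv with hov | ⟨f, _, _, rfl⟩
  · rcases hnv' with hov' | ⟨f, _, _, rfl⟩
    · apply hres hov hov'
      refine ⟨ord_res_half hov hov' W h1 hmin hs hsW hm, fun y hy => ?_⟩
      obtain ⟨x, hx, hxy⟩ := ord_res_half hov' hov W h2 (fun V a b => hmin V b a) hs hsW hm' y hy
      refine ⟨x, hx, ?_⟩
      have := mball_neg (good_val W) hxy
      rwa [neg_sub] at this
    · exact hi.1 (abs_absorb hG f hN0 hs hN hm)
  · exact hi.2 (abs_absorb hG' f hN0' hs hN' hm')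

/-- `x` is small at `O` relative to `1`, `t`, `b`. -/
def Sm (t b : K) (O : Set K) (x : K) : Prop :=
  x ∈ mball O ∧ t⁻¹ * x ∈ mball O ∧ b⁻¹ * x ∈ mball O

theorem Sm.mul {t b : K} {O : Set K} (h : Good O) {x : K} (hx : Sm t b O x) {a : K}
    (ha : a ∈ O) : Sm t b O (x * a) := by
  obtain ⟨h1, h2, h3⟩ := hx
  refine ⟨?_, ?_, ?_⟩
  · rw [mul_comm]; exact h.mball_mul ha h1
  · rw [← mul_assoc, mul_comm]; exact h.mball_mul ha h2
  · rw [← mul_assoc, mul_comm]; exact h.mball_mul ha h3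

theorem exists_g {t b : K} (ht : t ≠ 0) (hb : b ≠ 0) {O : Set K} (h : Good O)
    (W : ValuationSubring K) (htW : t⁻¹ ∈ W) (hbW : b⁻¹ ∈ W) :
    ∃ g : K, g ≠ 0 ∧ g⁻¹ ∈ W ∧ ∀ x ∈ mball O, Sm t b O (g * x) := by
  suffices ∃ g : K, g ≠ 0 ∧ g⁻¹ ∈ W ∧ g ∈ O ∧ t⁻¹ * g ∈ O ∧ b⁻¹ * g ∈ O by
    obtain ⟨g, h0, hW, h1, h2, h3⟩ := this
    refine ⟨g, h0, hW, fun x hx => ⟨h.mball_mul h1 hx, ?_, ?_⟩⟩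
    · rw [← mul_assoc]; exact h.mball_mul h2 hx
    · rw [← mul_assoc]; exact h.mball_mul h3 hx
  obtain ⟨g, h0, hW, h1, h2⟩ : ∃ g : K, g ≠ 0 ∧ g⁻¹ ∈ W ∧ g ∈ O ∧ t⁻¹ * g ∈ O := by
    rcases h.tot t with h1 | h1
    · exact ⟨t, ht, htW, h1, by rw [inv_mul_cancel₀ ht]; exact h.one⟩
    · exact ⟨1, one_ne_zero, by simpa using W.one_mem, h.one, by simpa using h1⟩
  rcases h.tot (b⁻¹ * g) with h3 | h3
  · exact ⟨g, h0, hW, h1, h2, h3⟩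
  · rw [mul_inv, inv_inv] at h3
    refine ⟨b, hb, hbW, ?_, ?_, ?_⟩
    · have := h.mul _ h3 _ h1
      rwa [inv_mul_cancel_right₀ h0] at this
    · have := h.mul _ h3 _ h2
      have e : b * g⁻¹ * (t⁻¹ * g) = t⁻¹ * b := by field_simp
      rwa [e] at this
    · rw [inv_mul_cancel₀ hb]; exact h.one

theorem pair_lemma {t b c : K} (ht : t ≠ 0) (hb : b ≠ 0) (hc : c ≠ 0) {v v' : Set K}
    (hv : IsLocality v) (hv' : IsLocality v') (hi : Incomp v v')
    (W : ValuationSubring K) (h1 : v ⊆ W) (h2 : v' ⊆ W)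
    (hmin : ∀ A : ValuationSubring K, v ⊆ A → v' ⊆ A → W ≤ A)
    (hres : IsOrderingLocality v → IsOrderingLocality v' → ¬ SameResidue (W : Set K) v v')
    (htW : t⁻¹ ∈ W) (hbW : b⁻¹ ∈ W) (hcW : c⁻¹ ∈ W) :
    ∃ α : K, α ≠ 0 ∧ Sm t b v α ∧ Sm t c v' α⁻¹ := by
  obtain ⟨g, g0, gW, hg⟩ := exists_g ht hb (good_loc hv) W htW hbW
  obtain ⟨h, h0, hW, hh⟩ := exists_g ht hc (good_loc hv') W htW hcW
  by_contra hcon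
  push Not at hcon
  refine pair_contra hv hv' hi W h1 h2 hmin hres (s := g⁻¹ * h⁻¹)
    (mul_ne_zero (inv_ne_zero g0) (inv_ne_zero h0)) (W.mul_mem _ _ gW hW) ?_
  intro x hx
  by_contra hc2
  have hx0 : x ≠ 0 := by
    rintro rfl
    rw [mul_zero] at hc2
    exact hc2 (good_loc hv').zero
  have h3 := hh _ ((good_loc hv').inv_mem_mball hc2)
  refine hcon (g * x) (mul_ne_zero g0 hx0) (hg x hx) ?_
  convert h3 using 1
  field_simp

theorem f_ne_zero {t : K} (ht : t ≠ 0) {f : Polynomial K} {O : Set K} (h : Good O)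
    (hII : CondII t f O) (hIII : CondIII t f O) (x : K) : f.eval x ≠ 0 := by
  have h0 : (0 : K) ∈ scale t (mball O) :=
    ⟨0, by rw [mem_mball]; exact ⟨h.zero, Or.inl rfl⟩, by simp⟩
  intro hf
  by_cases hx : x ∈ O
  · exact hII x hx (by rw [hf]; exact h0)
  · obtain ⟨⟨w, hw, hfw⟩, -⟩ := hIII x hx
    have hx0 : x ≠ 0 := by
      rintro rfl
      exact hx h.zero
    rw [hf] at hfw
    rcases mul_eq_zero.1 hfw.symm with h1 | h1
    · exact pow_ne_zero _ hx0 h1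
    · subst h1
      exact hw.2 h0

/-- if `w ∉ t·m` then `t / w ∈ O`. -/
theorem div_mem {t : K} (ht : t ≠ 0) {O : Set K} (h : Good O) {w : K}
    (hw : w ∉ scale t (mball O)) : t * w⁻¹ ∈ O := by
  rw [mem_scale ht] at hw
  have := h.inv_mem_of_not hw
  rwa [mul_inv, inv_inv] at this

theorem F_upper {t : K} {f : Polynomial K} (hd : 2 ≤ f.natDegree) {O : Set K} (h : Good O)
    (hI : CondI f O) (hIII : CondIII t f O) {x y : K} (hy0 : y ≠ 0) (hx : x ∈ O) (hy : y ∈ O) :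
    (∃ a ∈ O, y ^ f.natDegree * f.eval (x / y) = x * a) ∨
      ∃ a ∈ O, y ^ f.natDegree * f.eval (x / y) = y * a := by
  obtain ⟨d, hd'⟩ : ∃ d, f.natDegree = d + 1 := ⟨f.natDegree - 1, by omega⟩
  by_cases hr : x / y ∈ O
  · right
    refine ⟨y ^ d * f.eval (x / y), h.mul _ (h.pow hy d) _ (hI _ hr), ?_⟩
    rw [hd']; ring
  · left
    obtain ⟨⟨w, hw, hfw⟩, -⟩ := hIII _ hr
    refine ⟨x ^ d * w, h.mul _ (h.pow hx d) _ hw.1, ?_⟩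
    rw [hfw, hd', div_pow]
    field_simp
    ring

theorem F_lower {t : K} (ht : t ≠ 0) {f : Polynomial K} (hd : 2 ≤ f.natDegree) {O : Set K}
    (h : Good O) (hII : CondII t f O) (hIII : CondIII t f O) {b : K} {x y : K} (hx0 : x ≠ 0)
    (hy0 : y ≠ 0) (hxy : Sm t b O x⁻¹ ∨ Sm t b O y⁻¹) :
    Sm t b O (y ^ f.natDegree * f.eval (x / y))⁻¹ := by
  have hf := f_ne_zero ht h hII hIII (x / y)
  obtain ⟨d, hd'⟩ : ∃ d, f.natDegree = d + 2 := ⟨f.natDegree - 2, by omega⟩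
  have aux : ∀ u q w : K, u ≠ 0 → w ≠ 0 → Sm t b O u⁻¹ → t * w⁻¹ ∈ O → q = u ^ (d + 2) * w →
      Sm t b O q⁻¹ := by
    rintro u q w hu hw0 hs hw rfl
    have e : (u ^ (d + 2) * w)⁻¹ = u⁻¹ * ((t⁻¹ * u⁻¹) * ((u⁻¹) ^ d * (t * w⁻¹))) := by
      rw [inv_pow]
      field_simp
      try ring
    rw [e]
    exact hs.mul h (h.mul _ hs.2.1.1 _ (h.mul _ (h.pow hs.1.1 d) _ hw))
  by_cases hr : x / y ∈ O
  · have hs : Sm t b O y⁻¹ := by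
      rcases hxy with h1 | h1
      · have := h1.mul h hr
        have e : x⁻¹ * (x / y) = y⁻¹ := by field_simp
        rwa [e] at this
      · exact h1
    exact aux y _ _ hy0 hf hs (div_mem ht h (hII _ hr)) (by rw [hd'])
  · have hri : (x / y)⁻¹ ∈ O := (h.tot _).resolve_left hr
    have hs : Sm t b O x⁻¹ := by
      rcases hxy with h1 | h1
      · exact h1
      · have := h1.mul h hri
        have e : y⁻¹ * (x / y)⁻¹ = x⁻¹ := by field_simp
        rwa [e] at this
    obtain ⟨⟨w, hw, hfw⟩, -⟩ := hIII _ hr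
    have hw0 : w ≠ 0 := by
      rintro rfl
      rw [mul_zero] at hfw
      exact hf hfw
    refine aux x _ w hx0 hw0 hs (div_mem ht h hw.2) ?_
    rw [hfw, hd', div_pow]
    field_simp

theorem comb {t : K} (ht : t ≠ 0) {f : Polynomial K} (hd : 2 ≤ f.natDegree) {S : Set (Set K)}
    (hne : S.Nonempty) (hG : ∀ O ∈ S, Good O)
    (hU : ∀ v ∈ S, CondI f v ∧ CondII t f v ∧ CondIII t f v ∧ CondIV t v)
    (l : Finset K) (hl : l.Nonempty) (hl0 : ∀ α ∈ l, α ≠ 0) :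
    ∃ γ : K, γ ≠ 0 ∧ ∀ O ∈ S, ∀ b : K, ((∀ α ∈ l, Sm t b O α) → Sm t b O γ) ∧
      ((∃ α ∈ l, Sm t b O α⁻¹) → Sm t b O γ⁻¹) := by
  classical
  induction hl using Finset.Nonempty.cons_induction with
  | singleton a =>
    exact ⟨a, hl0 a (by simp), fun O _ b => by simp⟩
  | cons a s ha hs ih =>
    obtain ⟨γ, hγ, hγS⟩ := ih (fun α hα => hl0 α (by simp [hα]))
    have ha0 : a ≠ 0 := hl0 a (by simp)
    obtain ⟨O₀, hO₀⟩ := hne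
    refine ⟨γ ^ f.natDegree * f.eval (a / γ), mul_ne_zero (pow_ne_zero _ hγ)
      (f_ne_zero ht (hG _ hO₀) (hU _ hO₀).2.1 (hU _ hO₀).2.2.1 _), ?_⟩
    intro O hO b
    obtain ⟨hI, hII, hIII, -⟩ := hU O hO
    have hg := hG O hO
    constructor
    · intro hsm
      have h1 : Sm t b O a := hsm a (by simp)
      have h2 : Sm t b O γ := (hγS O hO b).1 (fun α hα => hsm α (by simp [hα]))
      rcases F_upper hd hg hI hIII hγ h1.1.1 h2.1.1 with ⟨q, hq, e⟩ | ⟨q, hq, e⟩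
      · rw [e]; exact h1.mul hg hq
      · rw [e]; exact h2.mul hg hq
    · rintro ⟨α, hα, hsm⟩
      apply F_lower ht hd hg hII hIII ha0 hγ
      rw [Finset.mem_cons] at hα
      rcases hα with rfl | hα
      · exact Or.inl hsm
      · exact Or.inr ((hγS O hO b).2 ⟨α, hα, hsm⟩)

theorem cpt {t c : K} {X : Set (Set K)} (hX : @IsCompact (Set K) (zarStarTop K) X)
    (hXne : X.Nonempty) (G : Set K) (h : ∀ O ∈ X, ∃ α ∈ G, Sm t c O α⁻¹) :
    ∃ l : Finset K, l.Nonempty ∧ (∀ α ∈ l, α ∈ G) ∧ ∀ O ∈ X, ∃ α ∈ l, Sm t c O α⁻¹ := by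
  classical
  letI : TopologicalSpace (Set K) := zarStarTop K
  have hop : ∀ x : K, IsOpen {O : Set K | x ∈ mball O} := fun x =>
    TopologicalSpace.isOpen_generateFrom_of_mem ⟨x, rfl⟩
  obtain ⟨l, hl⟩ := hX.elim_finite_subcover (fun α : G => {O : Set K | Sm t c O (α : K)⁻¹})
    (fun α => (hop _).inter ((hop _).inter (hop _)))
    (fun O hO => by
      obtain ⟨α, hα, hs⟩ := h O hO
      exact Set.mem_iUnion.2 ⟨⟨α, hα⟩, hs⟩)
  have hcov : ∀ O ∈ X, ∃ α ∈ l.image (Subtype.val : G → K), Sm t c O α⁻¹ := by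
    intro O hO
    obtain ⟨α, hα, hs⟩ := Set.mem_iUnion₂.1 (hl hO)
    exact ⟨α, Finset.mem_image_of_mem _ hα, hs⟩
  refine ⟨l.image Subtype.val, ?_, ?_, hcov⟩
  · obtain ⟨O, hO⟩ := hXne
    obtain ⟨α, hα, _⟩ := hcov O hO
    exact ⟨α, hα⟩
  · intro α hα
    obtain ⟨a, _, rfl⟩ := Finset.mem_image.1 hα
    exact a.2

/-- Separation of two compact sets. -/
theorem sep_two {t b c : K} (ht : t ≠ 0) {f : Polynomial K} (hd : 2 ≤ f.natDegree)
    {S X Y : Set (Set K)} (hG : ∀ O ∈ S, Good O)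
    (hU : ∀ v ∈ S, CondI f v ∧ CondII t f v ∧ CondIII t f v ∧ CondIV t v)
    (hXS : X ⊆ S) (hYS : Y ⊆ S) (hXne : X.Nonempty) (hYne : Y.Nonempty)
    (hX : @IsCompact (Set K) (zarStarTop K) X) (hY : @IsCompact (Set K) (zarStarTop K) Y)
    (hp : ∀ v ∈ X, ∀ w ∈ Y, ∃ α : K, α ≠ 0 ∧ Sm t b v α ∧ Sm t c w α⁻¹) :
    ∃ α : K, α ≠ 0 ∧ (∀ v ∈ X, Sm t b v α) ∧ ∀ w ∈ Y, Sm t c w α⁻¹ := by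
  have hSne : S.Nonempty := hXne.mono hXS
  have step : ∀ v ∈ X, ∃ α : K, α ≠ 0 ∧ Sm t b v α ∧ ∀ w ∈ Y, Sm t c w α⁻¹ := by
    intro v hv
    obtain ⟨l, hl, hlG, hlY⟩ := cpt (t := t) (c := c) hY hYne {α | α ≠ 0 ∧ Sm t b v α} (by
      intro w hw
      obtain ⟨α, h0, h1, h2⟩ := hp v hv w hw
      exact ⟨α, ⟨h0, h1⟩, h2⟩)
    obtain ⟨γ, hγ, hγS⟩ := comb ht hd hSne hG hU l hl (fun α hα => (hlG α hα).1)
    exact ⟨γ, hγ, (hγS v (hXS hv) b).1 (fun α hα => (hlG α hα).2),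
      fun w hw => (hγS w (hYS hw) c).2 (hlY w hw)⟩
  obtain ⟨l, hl, hlG, hlX⟩ := cpt (t := t) (c := b) hX hXne
    {δ | δ ≠ 0 ∧ ∀ w ∈ Y, Sm t c w δ} (by
      intro v hv
      obtain ⟨α, h0, h1, h2⟩ := step v hv
      exact ⟨α⁻¹, ⟨inv_ne_zero h0, h2⟩, by rwa [inv_inv]⟩)
  obtain ⟨δ, hδ, hδS⟩ := comb ht hd hSne hG hU l hl (fun α hα => (hlG α hα).1)
  refine ⟨δ⁻¹, inv_ne_zero hδ, fun v hv => (hδS v (hXS hv) b).2 (hlX v hv), fun w hw => ?_⟩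
  rw [inv_inv]
  exact (hδS w (hYS hw) c).1 (fun α hα => (hlG α hα).2 w hw)


/-- **Lemma 4.4** (induction step, Situation `m`): approximation of `x'` on `S 0` and of
`x''` on the remaining `S i`. -/
theorem induction_lemma {K : Type*} [Field K] (t : K) (ht : t ≠ 0)
    (S : Set (Set K)) (hSloc : ∀ v ∈ S, IsLocality v) (hU : AssumptionU S t)
    (n : ℕ) (Si : Fin (n + 1) → Set (Set K)) (hsub : ∀ i, Si i ⊆ S)
    (hne : ∀ i, (Si i).Nonempty)
    (hcpt : ∀ i, @IsCompact (Set K) (zarStarTop K) (Si i))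
    (hti : ∀ i j, i ≠ j → SetTIndep t (Si i) (Si j))
    (hinc : ∀ i j, i ≠ j → SetIncomp (Si i) (Si j))
    (x' x'' : K) (z : Fin (n + 1) → K) (hz : ∀ i, z i ≠ 0)
    (hzz : ∀ i j, i ≠ j → ∀ W : Set K, IsValuationLocality W →
      (∃ v ∈ Si i, v ⊆ W) → (∃ v ∈ Si j, v ⊆ W) → scale (z i) W = scale (z j) W)
    (hx : ∀ i, i ≠ (0 : Fin (n + 1)) → ∀ W : Set K, IsValuationLocality W →
      (∃ v ∈ Si 0, v ⊆ W) → (∃ v ∈ Si i, v ⊆ W) → x' - x'' ∈ scale (z 0) W) :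
    ∃ x : K, (∀ v ∈ Si 0, x - x' ∈ scale (z 0) (mball v)) ∧
      ∀ i, i ≠ (0 : Fin (n + 1)) → ∀ v ∈ Si i, x - x'' ∈ scale (z i) (mball v) := by
  classical
  have hG : ∀ O ∈ S, Good O := fun O hO => good_loc (hSloc O hO)
  have zero_sc : ∀ (z : K) (v : Set K), Good v → (0 : K) ∈ scale z (mball v) := fun z v hv =>
    ⟨0, mem_mball.2 ⟨hv.zero, Or.inl rfl⟩, by simp⟩
  by_cases hn : n = 0
  · subst hn
    refine ⟨x', fun v hv => ?_, fun i hi => absurd (Fin.ext (by omega)) hi⟩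
    rw [sub_self]
    exact zero_sc _ _ (hG v (hsub 0 hv))
  by_cases hu : x' - x'' = 0
  · refine ⟨x', fun v hv => ?_, fun i _ v hv => ?_⟩
    · rw [sub_self]
      exact zero_sc _ _ (hG v (hsub 0 hv))
    · rw [hu]
      exact zero_sc _ _ (hG v (hsub i hv))
  obtain ⟨f, hd, hf⟩ := hU
  obtain ⟨u, hudef⟩ : ∃ u, u = x' - x'' := ⟨_, rfl⟩
  rw [← hudef] at hu hx
  have hsep : ∀ i, i ≠ (0 : Fin (n + 1)) → ∃ α : K, α ≠ 0 ∧
      (∀ v ∈ Si 0, Sm t (t * (z 0 / u)) v α) ∧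
      ∀ w ∈ Si i, Sm t (t * t * (z i / u)) w α⁻¹ := by
    intro i hi
    refine sep_two ht hd hG hf (hsub 0) (hsub i) (hne 0) (hne i) (hcpt 0) (hcpt i) ?_
    intro v hv w hw
    have hlv := hSloc v (hsub 0 hv)
    have hlw := hSloc w (hsub i hw)
    have hinc' := hinc 0 i hi.symm v hv w hw
    obtain ⟨W, h1, h2, hmin⟩ := exists_W (good_loc hlv) w
    have hfcc := isFCC_of hlv hinc' W h1 h2 hmin
    obtain ⟨ht1, ht2⟩ := hti 0 i hi.symm v hv w hw
    obtain ⟨htW, htW'⟩ := ht1 _ hfcc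
    have hWl : IsValuationLocality (W : Set K) := ⟨W, rfl⟩
    have hux := hx i hi _ hWl ⟨v, hv, h1⟩ ⟨w, hw, h2⟩
    have huz := hux
    rw [hzz 0 i hi.symm _ hWl ⟨v, hv, h1⟩ ⟨w, hw, h2⟩] at huz
    rw [mem_scale (hz _)] at hux huz
    refine pair_lemma ht (mul_ne_zero ht (div_ne_zero (hz 0) hu))
      (mul_ne_zero (mul_ne_zero ht ht) (div_ne_zero (hz i) hu)) hlv hlw hinc' W h1 h2 hmin
      (fun a b => (ht2 a b).2 _ hfcc) htW' ?_ ?_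
    · have := W.mul_mem _ _ htW' hux
      convert this using 1
      have := hz 0
      field_simp
    · have := W.mul_mem _ _ (W.mul_mem _ _ htW' htW') huz
      convert this using 1
      have := hz i
      field_simp
  choose! α hα0 hα1 hα2 using hsep
  have hSne : S.Nonempty := (hne 0).mono (hsub 0)
  obtain ⟨γ, hγ, hγS⟩ := comb ht hd hSne hG hf
    ((Finset.univ.filter (fun i : Fin (n + 1) => i ≠ 0)).image α)
    (by
      refine ⟨α (Fin.last n), Finset.mem_image_of_mem _ ?_⟩
      simp only [Finset.mem_filter, Finset.mem_univ, true_and]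
      intro h
      apply hn
      simpa using congrArg Fin.val h)
    (by
      intro a ha
      obtain ⟨i, hi, rfl⟩ := Finset.mem_image.1 ha
      exact hα0 i (Finset.mem_filter.1 hi).2)
  have hγ0 : ∀ v ∈ Si 0, Sm t (t * (z 0 / u)) v γ := by
    intro v hv
    refine (hγS v (hsub 0 hv) _).1 ?_
    intro a ha
    obtain ⟨i, hi, rfl⟩ := Finset.mem_image.1 ha
    exact hα1 i (Finset.mem_filter.1 hi).2 v hv
  have hγi : ∀ i, i ≠ (0 : Fin (n + 1)) → ∀ w ∈ Si i, Sm t (t * t * (z i / u)) w γ⁻¹ := by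
    intro i hi w hw
    refine (hγS w (hsub i hw) _).2 ⟨α i, Finset.mem_image_of_mem _ (by simp [hi]), hα2 i hi w hw⟩
  obtain ⟨a, ha⟩ : ∃ a, a = γ⁻¹ := ⟨_, rfl⟩
  have hγa : γ = a⁻¹ := by rw [ha, inv_inv]
  subst hγa
  simp only [inv_inv] at hγi
  have ha0 : a ≠ 0 := by simpa using hγ
  obtain ⟨d, hd'⟩ : ∃ d, f.natDegree = d + 1 := ⟨f.natDegree - 1, by omega⟩
  obtain ⟨O₀, hO₀⟩ := hSne
  have hfa : f.eval a ≠ 0 := f_ne_zero ht (hG _ hO₀) (hf _ hO₀).2.1 (hf _ hO₀).2.2.1 a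
  refine ⟨x'' + f.leadingCoeff * a ^ f.natDegree / f.eval a * u, fun v hv => ?_,
    fun i hi v hv => ?_⟩
  · have hg := hG v (hsub 0 hv)
    have hs := hγ0 v hv
    have hav : a ∉ v := Good.not_mem_of_inv ha0 hs.1
    obtain ⟨⟨w, hw, hfw⟩, ⟨q, hq, hfq⟩⟩ := (hf v (hsub 0 hv)).2.2.1 a hav
    have hw0 : w ≠ 0 := by
      rintro rfl
      rw [mul_zero] at hfw
      exact hfa hfw
    have hk := hg.mball_mul (hg.mul _ (hg.neg _ hq) _ (div_mem ht hg hw.2)) hs.2.2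
    rw [mem_scale (hz 0)]
    convert hk using 1
    have e1 : f.leadingCoeff * a ^ f.natDegree = a ^ (d + 1) * w - a ^ d * q := by
      rw [hfq, hd'] at hfw
      rw [hd', ← hfw]
      simp
    rw [e1, hfw, hd']
    have e2 : x' = x'' + u := by rw [hudef]; ring
    rw [e2]
    have := hz 0
    field_simp
    ring
  · have hg := hG v (hsub i hv)
    have hs := hγi i hi v hv
    obtain ⟨hI, hII, hIII, hIV⟩ := hf v (hsub i hv)
    have hav : a⁻¹ ∉ v := Good.not_mem_of_inv (inv_ne_zero ha0) (by rw [inv_inv]; exact hs.1)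
    obtain ⟨⟨w, hw, hfw⟩, ⟨q, hq, hfq⟩⟩ := hIII _ hav
    have hlc : f.leadingCoeff = w + -(a * q) := by
      rw [hfq, hd'] at hfw
      simp only [Nat.add_sub_cancel] at hfw
      have h1 : a ^ (d + 1) * (f.leadingCoeff * a⁻¹ ^ (d + 1) + a⁻¹ ^ d * q) =
          a ^ (d + 1) * (a⁻¹ ^ (d + 1) * w) := by rw [hfw]
      have h2 : a ^ (d + 1) * (f.leadingCoeff * a⁻¹ ^ (d + 1) + a⁻¹ ^ d * q) =
          f.leadingCoeff + a * q := by
        simp only [inv_pow]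
        field_simp
        try ring
      have h3 : a ^ (d + 1) * (a⁻¹ ^ (d + 1) * w) = w := by
        rw [inv_pow]
        field_simp
      rw [h2, h3] at h1
      rw [← h1]; ring
    have hlc' := hIV _ hw.1 _ (hg.neg _ (hg.mul _ hs.1.1 _ hq))
    rw [← hlc, mem_scale (inv_ne_zero ht), inv_inv] at hlc'
    have hk := hg.mball_mul (hg.mul _ hlc' _ (hg.mul _ (hg.pow hs.1.1 d) _
      (div_mem ht hg (hII _ hs.1.1)))) hs.2.2
    rw [mem_scale (hz i)]
    convert hk using 1
    rw [hd']
    have := hz i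
    field_simp
    ring

end PaperApprox
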